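/- arXiv:2307.09974 — 4 statements merged into one kernel-verified Lean document; each statement's English description precedes it below -/
import Mathlib

section
/- Let A ∈ ℝ^{d×d}, let Q ∈ ℝ^{d×d} be symmetric positive definite, and suppose C₀, C₁ ∈ ℝ^{d×d} satisfy det C₀ ≠ 0 and Q + wA + w⁻¹Aᵀ = (C₀ᵀ + w⁻¹ C₁ᵀ)(C₀ + w C₁) as complex matrices for every w ∈ ℂ with w ≠ 0. Then X = C₀ᵀ C₀ is a symmetric positive definite solution of X + Aᵀ X⁻¹ A = Q. -/
open Matrix

namespace Matrix

variable {m n : Type*}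

/-- A Laurent polynomial `P + w R + w⁻¹ S` with matrix coefficients over `ℝ` is determined by its
values at the nonzero reals. -/
lemma laurent_coeff_unique {P R S P' R' S' : Matrix m n ℝ}
    (h : ∀ w : ℝ, w ≠ 0 → P + w • R + w⁻¹ • S = P' + w • R' + w⁻¹ • S') :
    P = P' ∧ R = R' := by
  have key (i : m) (j : n) : P i j = P' i j ∧ R i j = R' i j := by
    have h₁ := congrFun₂ (h 1 one_ne_zero) i j
    have h₂ := congrFun₂ (h (-1) (by norm_num)) i j
    have h₃ := congrFun₂ (h 2 two_ne_zero) i j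
    norm_num at h₁ h₂ h₃
    constructor <;> linarith
  exact ⟨ext fun i j => (key i j).1, ext fun i j => (key i j).2⟩

variable [Fintype n]

/-- A factorization of `Q + w A + w⁻¹ Aᵀ` over the nonzero complex numbers into real factors
restricts to the nonzero reals. -/
lemma real_factorization_of_complex {A Q C₀ C₁ : Matrix n n ℝ}
    (h : ∀ w : ℂ, w ≠ 0 →
      Q.map Complex.ofReal + w • A.map Complex.ofReal + w⁻¹ • Aᵀ.map Complex.ofReal =
        (C₀ᵀ.map Complex.ofReal + w⁻¹ • C₁ᵀ.map Complex.ofReal) *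
        (C₀.map Complex.ofReal + w • C₁.map Complex.ofReal))
    (w : ℝ) (hw : w ≠ 0) :
    Q + w • A + w⁻¹ • Aᵀ = (C₀ᵀ + w⁻¹ • C₁ᵀ) * (C₀ + w • C₁) := by
  ext i j
  have hij := congrFun₂ (h w (Complex.ofReal_ne_zero.mpr hw)) i j
  simp only [add_apply, smul_apply, map_apply, mul_apply, smul_eq_mul] at hij ⊢
  exact_mod_cast hij

/-- Comparing coefficients in `Q + w A + w⁻¹ Aᵀ = (C₀ᵀ + w⁻¹ C₁ᵀ) (C₀ + w C₁)`. -/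
lemma coeff_of_factorization {A Q C₀ C₁ : Matrix n n ℝ}
    (h : ∀ w : ℝ, w ≠ 0 →
      Q + w • A + w⁻¹ • Aᵀ = (C₀ᵀ + w⁻¹ • C₁ᵀ) * (C₀ + w • C₁)) :
    Q = C₀ᵀ * C₀ + C₁ᵀ * C₁ ∧ A = C₀ᵀ * C₁ := by
  refine laurent_coeff_unique (S := Aᵀ) (S' := C₁ᵀ * C₀) fun w hw => ?_
  rw [h w hw]
  simp only [add_mul, mul_add, smul_mul_assoc, mul_smul_comm, smul_add, smul_smul,
    mul_inv_cancel₀ hw, one_smul]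
  abel

end Matrix

/-- Theorem 4.3 (Engwerda), converse direction: if `det C₀ ≠ 0` and
`Q + wA + w⁻¹Aᵀ = (C₀ᵀ + w⁻¹C₁ᵀ)(C₀ + wC₁)` for every nonzero complex `w`, then
`X = C₀ᵀ C₀` is a symmetric positive definite solution of `X + Aᵀ X⁻¹ A = Q`. -/
theorem nme_factorization_gives_solution
    (d : ℕ) (A Q : Matrix (Fin d) (Fin d) ℝ) (hQ : Q.PosDef)
    (C₀ C₁ : Matrix (Fin d) (Fin d) ℝ)
    (hC₀ : C₀.det ≠ 0)
    (hfact : ∀ w : ℂ, w ≠ 0 →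
      Q.map Complex.ofReal + w • A.map Complex.ofReal + w⁻¹ • Aᵀ.map Complex.ofReal =
        (C₀ᵀ.map Complex.ofReal + w⁻¹ • C₁ᵀ.map Complex.ofReal) *
        (C₀.map Complex.ofReal + w • C₁.map Complex.ofReal)) :
    (C₀ᵀ * C₀).PosDef ∧ C₀ᵀ * C₀ + Aᵀ * (C₀ᵀ * C₀)⁻¹ * A = Q := by
  have hu : IsUnit C₀.det := hC₀.isUnit
  obtain ⟨rfl, rfl⟩ := coeff_of_factorization (real_factorization_of_complex hfact)
  constructor
  · rw [← conjTranspose_eq_transpose_of_trivial]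
    exact PosDef.conjTranspose_mul_self C₀
      (mulVec_injective_of_isUnit ((isUnit_iff_isUnit_det C₀).mpr hu))
  · have hut : IsUnit C₀ᵀ.det := by rwa [det_transpose]
    rw [Matrix.mul_inv_rev, transpose_mul, transpose_transpose]
    simp only [Matrix.mul_assoc]
    rw [nonsing_inv_mul_cancel_left _ _ hut, mul_nonsing_inv_cancel_left _ _ hu]
end

section
/- Let A ∈ ℝ^{d×d} and suppose the equation X + Aᵀ X⁻¹ A = I_d has a symmetric positive definite solution. Define S₀ = I_d and S_{n+1} = I_d − Aᵀ S_n⁻¹ A for n ≥ 0. Then every S_n is symmetric positive definite, the sequence (S_n) converges (entrywise) to a symmetric positive definite matrix S satisfying S + Aᵀ S⁻¹ A = I_d, and S is the maximal solution: for every symmetric positive definite solution X̃ of X + Aᵀ X⁻¹ A = I_d, the matrix S − X̃ is positive semidefinite. -/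
open Matrix Filter

section MatrixOrder

variable {n : Type*} [Fintype n]

theorem Matrix.PosSemidef.of_tendsto {ι : Type*} {l : Filter ι} [l.NeBot]
    {u : ι → Matrix n n ℝ} {M : Matrix n n ℝ} (hu : ∀ k, (u k).PosSemidef)
    (h : Tendsto u l (nhds M)) : M.PosSemidef := by
  refine .of_dotProduct_mulVec_nonneg ?_ fun x => ?_
  · have hstar : Tendsto (fun k => (u k)ᴴ) l (nhds Mᴴ) :=
      (continuous_id.matrix_conjTranspose.tendsto M).comp h
    exact tendsto_nhds_unique (hstar.congr fun k => (hu k).isHermitian) h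
  · have hcont : Continuous fun N : Matrix n n ℝ => star x ⬝ᵥ (N *ᵥ x) := by fun_prop
    exact ge_of_tendsto' ((hcont.tendsto M).comp h) fun k => (hu k).dotProduct_mulVec_nonneg x

variable [DecidableEq n]

theorem Matrix.PosDef.posSemidef_inv_sub_inv {X Y : Matrix n n ℝ} (hX : X.PosDef) (hY : Y.PosDef)
    (h : (Y - X).PosSemidef) : (X⁻¹ - Y⁻¹).PosSemidef := by
  let := hX.inv.isUnit.invertible
  let := hY.isUnit.invertible
  have hdet : IsUnit X.det := (X.isUnit_iff_isUnit_det).1 hX.isUnit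
  have key := (hX.inv.fromBlocks₂₂ Y (1 : Matrix n n ℝ)).2
    (by simpa [nonsing_inv_nonsing_inv X hdet] using h)
  simpa using (hY.fromBlocks₁₁ (1 : Matrix n n ℝ) X⁻¹).1 key

theorem Matrix.IsHermitian.apply_eq_half_quadratic {M : Matrix n n ℝ} (hM : M.IsHermitian)
    (i j : n) :
    M i j = ((Pi.single i 1 + Pi.single j 1) ⬝ᵥ (M *ᵥ (Pi.single i 1 + Pi.single j 1))
      - Pi.single i 1 ⬝ᵥ (M *ᵥ Pi.single i 1)
      - Pi.single j 1 ⬝ᵥ (M *ᵥ Pi.single j 1)) / 2 := by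
  have hsymm : M j i = M i j := by simpa using hM.apply i j
  simp only [mulVec_add, add_dotProduct, dotProduct_add, mulVec_single_one, single_one_dotProduct,
    col_apply, hsymm]
  ring

theorem Matrix.exists_tendsto_of_antitone_of_bddBelow {u : ℕ → Matrix n n ℝ} {X : Matrix n n ℝ}
    (hu : ∀ k, (u k).IsHermitian) (hanti : ∀ k, (u k - u (k + 1)).PosSemidef)
    (hbdd : ∀ k, (u k - X).PosSemidef) : ∃ L, Tendsto u atTop (nhds L) := by
  have hquad (x : n → ℝ) : ∃ c, Tendsto (fun k => x ⬝ᵥ (u k *ᵥ x)) atTop (nhds c) := by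
    refine ⟨_, tendsto_atTop_ciInf (antitone_nat_of_succ_le fun k => ?_)
      ⟨x ⬝ᵥ (X *ᵥ x), ?_⟩⟩
    · simpa [sub_mulVec, dotProduct_sub] using (hanti k).dotProduct_mulVec_nonneg x
    · rintro _ ⟨k, rfl⟩
      simpa [sub_mulVec, dotProduct_sub] using (hbdd k).dotProduct_mulVec_nonneg x
  choose q hq using hquad
  refine ⟨fun i j => (q (Pi.single i 1 + Pi.single j 1) - q (Pi.single i 1)
    - q (Pi.single j 1)) / 2, tendsto_pi_nhds.2 fun i => tendsto_pi_nhds.2 fun j => ?_⟩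
  exact ((((hq _).sub (hq _)).sub (hq _)).div_const 2).congr fun k =>
    ((hu k).apply_eq_half_quadratic i j).symm

end MatrixOrder

/-- Engwerda's recursive algorithm (Section 4.2): if `X + Aᵀ X⁻¹ A = I` has a symmetric
positive definite solution, then the iterates `S₀ = I`, `S_{n+1} = I - Aᵀ S_n⁻¹ A` are all
symmetric positive definite and converge to a symmetric positive definite matrix `S` which is
the maximal solution of the equation. -/
theorem nme_recursive_algorithm_converges_to_maximal
    (d : ℕ) (A : Matrix (Fin d) (Fin d) ℝ)
    (hex : ∃ X : Matrix (Fin d) (Fin d) ℝ, X.PosDef ∧ X + Aᵀ * X⁻¹ * A = 1)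
    (S : ℕ → Matrix (Fin d) (Fin d) ℝ)
    (hS0 : S 0 = 1)
    (hSrec : ∀ n, S (n + 1) = 1 - Aᵀ * (S n)⁻¹ * A) :
    (∀ n, (S n).PosDef) ∧
    ∃ L : Matrix (Fin d) (Fin d) ℝ, L.PosDef ∧
      Tendsto S atTop (nhds L) ∧
      L + Aᵀ * L⁻¹ * A = 1 ∧
      (∀ X : Matrix (Fin d) (Fin d) ℝ, X.PosDef → X + Aᵀ * X⁻¹ * A = 1 →
        (L - X).PosSemidef) := by
  have conj {M : Matrix (Fin d) (Fin d) ℝ} (hM : M.PosSemidef) : (Aᵀ * M * A).PosSemidef := by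
    simpa using hM.conjTranspose_mul_mul_same A
  have posDef_of_sub {X Y : Matrix (Fin d) (Fin d) ℝ} (hX : X.PosDef)
      (h : (Y - X).PosSemidef) : Y.PosDef := by
    simpa using hX.add_posSemidef h
  have lower (X : Matrix (Fin d) (Fin d) ℝ) (hX : X.PosDef) (hEq : X + Aᵀ * X⁻¹ * A = 1)
      (n : ℕ) : (S n - X).PosSemidef := by
    induction n with
    | zero =>
      rw [hS0, ← hEq, add_sub_cancel_left]
      exact conj hX.inv.posSemidef
    | succ n ih =>
      have hstep : S (n + 1) - X = Aᵀ * (X⁻¹ - (S n)⁻¹) * A := by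
        rw [hSrec, ← hEq, mul_sub, sub_mul]
        abel
      rw [hstep]
      exact conj (hX.posSemidef_inv_sub_inv (posDef_of_sub hX ih) ih)
  obtain ⟨X, hX, hEq⟩ := hex
  have hpos (n : ℕ) : (S n).PosDef := posDef_of_sub hX (lower X hX hEq n)
  have hanti (n : ℕ) : (S n - S (n + 1)).PosSemidef := by
    induction n with
    | zero =>
      rw [hSrec, hS0, sub_sub_cancel]
      exact conj PosDef.one.inv.posSemidef
    | succ n ih =>
      have hstep : S (n + 1) - S (n + 1 + 1) = Aᵀ * ((S (n + 1))⁻¹ - (S n)⁻¹) * A := by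
        rw [hSrec (n + 1), hSrec n, mul_sub, sub_mul]
        abel
      rw [hstep]
      exact conj ((hpos (n + 1)).posSemidef_inv_sub_inv (hpos n) ih)
  obtain ⟨L, hL⟩ := exists_tendsto_of_antitone_of_bddBelow (fun n => (hpos n).isHermitian) hanti
    (lower X hX hEq)
  have hmax (Y : Matrix (Fin d) (Fin d) ℝ) (hY : Y.PosDef) (hYEq : Y + Aᵀ * Y⁻¹ * A = 1) :
      (L - Y).PosSemidef :=
    .of_tendsto (lower Y hY hYEq) (hL.sub_const Y)
  have hLpos : L.PosDef := posDef_of_sub hX (hmax X hX hEq)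
  have hinv : Tendsto (fun n => (S n)⁻¹) atTop (nhds L⁻¹) := by
    refine (continuousAt_matrix_inv L ?_).tendsto.comp hL
    rw [Ring.inverse_eq_inv']
    exact continuousAt_inv₀ hLpos.det_pos.ne'
  have hlim : Tendsto (fun n => S (n + 1)) atTop (nhds (1 - Aᵀ * L⁻¹ * A)) := by
    simp only [hSrec]
    exact ((hinv.const_mul Aᵀ).mul_const A).const_sub 1
  refine ⟨hpos, L, hLpos, hL, ?_, hmax⟩
  exact eq_sub_iff_add_eq.1 (tendsto_nhds_unique (hL.comp (tendsto_add_atTop_nat 1)) hlim)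
end

section
/- Let A ∈ ℝ^{d×d} and let Q ∈ ℝ^{d×d} be symmetric positive definite, with Q − AᵀQ⁻¹A and all subsequent iterates invertible where required. Define A^{(1)} = A Q⁻¹ A, B^{(1)} = A Q⁻¹ Aᵀ, Q^{(1)} = Q − Aᵀ Q⁻¹ A, and Q^{(k)} = Q^{(1)} − (A^{(1)})ᵀ (Q^{(k−1)} − B^{(1)})⁻¹ A^{(1)} for k ≥ 2. If there exists a symmetric positive definite matrix X_s such that Q − Aᵀ X_s⁻¹ A − X_s is positive semidefinite, then the limit Q^∞ = lim_{k→∞} Q^{(k)} exists and is the maximal symmetric positive definite solution of X + Aᵀ X⁻¹ A = Q, i.e., Q^∞ solves the equation and Q^∞ − X̃ is positive semidefinite for every symmetric positive definite solution X̃. -/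
open Matrix Filter

section MatrixOrder

open scoped MatrixOrder Topology

variable {n : Type*}

theorem Matrix.PosDef.of_le {X Y : Matrix n n ℝ} (hY : Y.PosDef) (h : Y ≤ X) : X.PosDef := by
  simpa using hY.add_posSemidef (le_iff.1 h)

variable [Fintype n]

theorem Matrix.PosDef.inv_anti [DecidableEq n] {X Y : Matrix n n ℝ} (hY : Y.PosDef)
    (h : Y ≤ X) : X⁻¹ ≤ Y⁻¹ := by
  have hX := hY.of_le h
  let _ := hX.isUnit.invertible
  let _ := hY.inv.isUnit.invertible
  have h₁ := PosDef.fromBlocks₁₁ (1 : Matrix n n ℝ) Y⁻¹ hX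
  have h₂ := PosDef.fromBlocks₂₂ X (1 : Matrix n n ℝ) hY.inv
  have hYY : Y⁻¹⁻¹ = Y := nonsing_inv_nonsing_inv Y ((isUnit_iff_isUnit_det Y).1 hY.isUnit)
  simp only [conjTranspose_one, one_mul, mul_one, hYY] at h₁ h₂
  exact h₁.1 (h₂.2 h)

theorem Matrix.isClosed_setOf_posSemidef : IsClosed {M : Matrix n n ℝ | M.PosSemidef} := by
  have : {M : Matrix n n ℝ | M.PosSemidef} =
      {M | Mᴴ = M} ∩ ⋂ x : n → ℝ, {M | 0 ≤ star x ⬝ᵥ (M *ᵥ x)} := by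
    ext M
    simp [posSemidef_iff_dotProduct_mulVec, IsHermitian]
  rw [this]
  refine (isClosed_eq (by fun_prop) continuous_id).inter (isClosed_iInter fun x => ?_)
  exact isClosed_le continuous_const (by fun_prop)

theorem Matrix.le_of_tendsto_of_forall_le {X : ℕ → Matrix n n ℝ} {Y L : Matrix n n ℝ}
    (hX : Tendsto X atTop (𝓝 L)) (h : ∀ k, Y ≤ X k) : Y ≤ L :=
  isClosed_setOf_posSemidef.mem_of_tendsto (hX.sub_const Y) (Eventually.of_forall h)

theorem Matrix.IsHermitian.apply_eq_quadratic [DecidableEq n] {M : Matrix n n ℝ}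
    (hM : M.IsHermitian) (i j : n) :
    M i j = ((Pi.single i 1 + Pi.single j 1) ⬝ᵥ (M *ᵥ (Pi.single i 1 + Pi.single j 1))
      - Pi.single i 1 ⬝ᵥ (M *ᵥ Pi.single i 1) - Pi.single j 1 ⬝ᵥ (M *ᵥ Pi.single j 1)) / 2 := by
  have hji : M j i = M i j := by simpa using hM.apply i j
  simp [mulVec_add, add_dotProduct, dotProduct_add, hji]
  ring

/-- A decreasing sequence of symmetric matrices that is bounded below converges. -/
theorem Matrix.exists_tendsto_of_antitone [DecidableEq n] {X : ℕ → Matrix n n ℝ}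
    {Y : Matrix n n ℝ} (hH : ∀ k, (X k).IsHermitian) (hX : Antitone X) (hY : ∀ k, Y ≤ X k) :
    ∃ L, Tendsto X atTop (𝓝 L) := by
  have hquad_mono : ∀ (x : n → ℝ) {M N : Matrix n n ℝ}, M ≤ N →
      x ⬝ᵥ (M *ᵥ x) ≤ x ⬝ᵥ (N *ᵥ x) := fun x M N h => by
    simpa [sub_mulVec] using (le_iff.1 h).dotProduct_mulVec_nonneg x
  have hquad : ∀ x : n → ℝ, ∃ l, Tendsto (fun k => x ⬝ᵥ (X k *ᵥ x)) atTop (𝓝 l) := fun x =>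
    ⟨_, tendsto_atTop_ciInf (fun _ _ h => hquad_mono x (hX h))
      ⟨x ⬝ᵥ (Y *ᵥ x), by rintro _ ⟨k, rfl⟩; exact hquad_mono x (hY k)⟩⟩
  choose l hl using hquad
  refine ⟨of fun i j => (l (Pi.single i 1 + Pi.single j 1) - l (Pi.single i 1)
    - l (Pi.single j 1)) / 2, tendsto_pi_nhds.2 fun i => tendsto_pi_nhds.2 fun j => ?_⟩
  simp_rw [fun k => (hH k).apply_eq_quadratic i j]
  exact (((hl _).sub (hl _)).sub (hl _)).div_const 2

theorem Matrix.PosDef.continuousAt_inv [DecidableEq n] {X : Matrix n n ℝ} (hX : X.PosDef) :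
    ContinuousAt Inv.inv X := by
  refine continuousAt_matrix_inv X ?_
  rw [Ring.inverse_eq_inv']
  exact continuousAt_inv₀ hX.det_pos.ne'

/-- The fixed-point map of the nonlinear matrix equation `X + Aᵀ X⁻¹ A = Q`. -/
noncomputable def nmeMap [DecidableEq n] (A Q X : Matrix n n ℝ) : Matrix n n ℝ :=
  Q - Aᵀ * X⁻¹ * A

theorem nmeMap_mono [DecidableEq n] (A Q : Matrix n n ℝ) {X Y : Matrix n n ℝ} (hY : Y.PosDef)
    (h : Y ≤ X) : nmeMap A Q Y ≤ nmeMap A Q X := by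
  have := (le_iff.1 (hY.inv_anti h)).conjTranspose_mul_mul_same A
  rw [conjTranspose_eq_transpose_of_trivial, mul_sub, sub_mul] at this
  rw [le_iff, nmeMap, nmeMap]
  convert this using 1
  abel

theorem le_of_le_nmeMap [DecidableEq n] {A Q Y : Matrix n n ℝ} (hY : Y.PosDef)
    (h : Y ≤ nmeMap A Q Y) : Y ≤ Q := by
  have := hY.inv.posSemidef.conjTranspose_mul_mul_same A
  rw [conjTranspose_eq_transpose_of_trivial] at this
  exact h.trans (by simpa [le_iff, nmeMap] using this)

theorem le_iterate_nmeMap [DecidableEq n] {A Q Y : Matrix n n ℝ} (hY : Y.PosDef)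
    (h : Y ≤ nmeMap A Q Y) (k : ℕ) : Y ≤ (nmeMap A Q)^[k] Q := by
  induction k with
  | zero => exact le_of_le_nmeMap hY h
  | succ k ih =>
    rw [Function.iterate_succ_apply']
    exact h.trans (nmeMap_mono A Q hY ih)

theorem antitone_iterate_nmeMap [DecidableEq n] {A Q Y : Matrix n n ℝ} (hY : Y.PosDef)
    (h : Y ≤ nmeMap A Q Y) : Antitone fun k => (nmeMap A Q)^[k] Q := by
  have hpos k := hY.of_le (le_iterate_nmeMap hY h k)
  refine antitone_nat_of_succ_le fun k => ?_
  induction k with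
  | zero =>
    have := (hY.of_le (le_of_le_nmeMap hY h)).inv.posSemidef.conjTranspose_mul_mul_same A
    rw [conjTranspose_eq_transpose_of_trivial] at this
    simpa [le_iff, nmeMap] using this
  | succ k ih =>
    simpa only [Function.iterate_succ_apply'] using nmeMap_mono A Q (hpos (k + 1)) ih

/-- If the equation has a positive definite subsolution, the fixed-point iteration started at `Q`
decreases to the maximal solution. -/
theorem exists_tendsto_iterate_nmeMap [DecidableEq n] {A Q Y : Matrix n n ℝ} (hY : Y.PosDef)
    (h : Y ≤ nmeMap A Q Y) :
    ∃ L : Matrix n n ℝ, Tendsto (fun k => (nmeMap A Q)^[k] Q) atTop (𝓝 L) ∧ L.PosDef ∧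
      nmeMap A Q L = L ∧ ∀ X : Matrix n n ℝ, X.PosDef → nmeMap A Q X = X → X ≤ L := by
  obtain ⟨L, hL⟩ := exists_tendsto_of_antitone
    (fun k => (hY.of_le (le_iterate_nmeMap hY h k)).isHermitian)
    (antitone_iterate_nmeMap hY h) (le_iterate_nmeMap hY h)
  have hLpos : L.PosDef := hY.of_le (le_of_tendsto_of_forall_le hL (le_iterate_nmeMap hY h))
  refine ⟨L, hL, hLpos, ?_, fun X hX hfix =>
    le_of_tendsto_of_forall_le hL (le_iterate_nmeMap hX hfix.ge)⟩
  have hcont : ContinuousAt (nmeMap A Q) L :=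
    ContinuousAt.comp (g := fun M => Q - Aᵀ * M * A)
      (by fun_prop : Continuous fun M => Q - Aᵀ * M * A).continuousAt hLpos.continuousAt_inv
  exact tendsto_nhds_unique (hcont.tendsto.comp hL)
    ((hL.comp (tendsto_add_atTop_nat 1)).congr fun k => Function.iterate_succ_apply' _ k Q)

/-- Two steps of the fixed-point iteration, by the Woodbury identity. -/
theorem nmeMap_nmeMap [DecidableEq n] {A Q X : Matrix n n ℝ} (hQ : IsUnit Q)
    (hX : IsUnit X) (hQsymm : Qᵀ = Q) (h : IsUnit (X - A * Q⁻¹ * Aᵀ)) :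
    nmeMap A Q (nmeMap A Q X) = Q - Aᵀ * Q⁻¹ * A -
      (A * Q⁻¹ * A)ᵀ * (X - A * Q⁻¹ * Aᵀ)⁻¹ * (A * Q⁻¹ * A) := by
  have hXX : X⁻¹⁻¹ = X := nonsing_inv_nonsing_inv X ((isUnit_iff_isUnit_det X).1 hX)
  have hneg : ∀ M : Matrix n n ℝ, IsUnit M → (-M)⁻¹ = -M⁻¹ := fun M hM =>
    inv_eq_left_inv (by
      rw [neg_mul_neg, nonsing_inv_mul M ((isUnit_iff_isUnit_det M).1 hM)])
  have hC : (-X⁻¹)⁻¹ + A * Q⁻¹ * Aᵀ = -(X - A * Q⁻¹ * Aᵀ) := by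
    rw [hneg _ (isUnit_nonsing_inv_iff.2 hX), hXX]; abel
  have hW := add_mul_mul_inv_eq_sub Q Aᵀ (-X⁻¹) A hQ (isUnit_nonsing_inv_iff.2 hX).neg
    (by rw [hC]; exact h.neg)
  rw [hC, hneg _ h] at hW
  have hsub : nmeMap A Q X = Q + Aᵀ * -X⁻¹ * A := by simp [nmeMap, sub_eq_add_neg]
  rw [nmeMap, hsub, hW]
  simp only [transpose_mul, transpose_nonsing_inv, hQsymm]
  noncomm_ring

end MatrixOrder

/-- Theorem 4.4 (Chiang): with `A⁽¹⁾ = AQ⁻¹A`, `B⁽¹⁾ = AQ⁻¹Aᵀ`, `Q⁽¹⁾ = Q - AᵀQ⁻¹A` and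
`Q⁽ᵏ⁾ = Q⁽¹⁾ - (A⁽¹⁾)ᵀ (Q⁽ᵏ⁻¹⁾ - B⁽¹⁾)⁻¹ A⁽¹⁾` for `k ≥ 2`, if there exists a symmetric
positive definite `X_s` with `Q - Aᵀ X_s⁻¹ A - X_s` positive semidefinite, then the iterates
`Q⁽ᵏ⁾` converge to the maximal symmetric positive definite solution of `X + Aᵀ X⁻¹ A = Q`. -/
theorem nme_chiang_algorithm_converges_to_maximal
    (d : ℕ) (A Q : Matrix (Fin d) (Fin d) ℝ) (hQ : Q.PosDef)
    (Qk : ℕ → Matrix (Fin d) (Fin d) ℝ)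
    (hQk1 : Qk 1 = Q - Aᵀ * Q⁻¹ * A)
    (hQkrec : ∀ k, 2 ≤ k →
      Qk k = Qk 1 - (A * Q⁻¹ * A)ᵀ * (Qk (k - 1) - A * Q⁻¹ * Aᵀ)⁻¹ * (A * Q⁻¹ * A))
    -- all iterates are invertible where required
    (hinv : ∀ k, 1 ≤ k → IsUnit (Qk k - A * Q⁻¹ * Aᵀ).det)
    (Xs : Matrix (Fin d) (Fin d) ℝ) (hXs : Xs.PosDef)
    (hXscond : (Q - Aᵀ * Xs⁻¹ * A - Xs).PosSemidef) :
    ∃ Qinf : Matrix (Fin d) (Fin d) ℝ,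
      Tendsto Qk atTop (nhds Qinf) ∧
      Qinf.PosDef ∧
      Qinf + Aᵀ * Qinf⁻¹ * A = Q ∧
      (∀ X : Matrix (Fin d) (Fin d) ℝ, X.PosDef → X + Aᵀ * X⁻¹ * A = Q →
        (Qinf - X).PosSemidef) := by
  obtain ⟨L, hL, hLpos, hfix, hmax⟩ := exists_tendsto_iterate_nmeMap (A := A) (Q := Q)
    hXs hXscond
  have hodd : ∀ k, Qk (k + 1) = (nmeMap A Q)^[2 * k + 1] Q := by
    intro k
    induction k with
    | zero => simpa [nmeMap] using hQk1
    | succ k ih =>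
      have hpos : (Qk (k + 1)).PosDef := by
        rw [ih]
        exact hXs.of_le (le_iterate_nmeMap hXs hXscond _)
      rw [hQkrec (k + 2) (by omega), show 2 * (k + 1) + 1 = 2 * k + 1 + 1 + 1 by ring,
        Function.iterate_succ_apply', Function.iterate_succ_apply', ← ih, hQk1,
        nmeMap_nmeMap hQ.isUnit hpos.isUnit (by simpa using hQ.isHermitian.eq)
          ((isUnit_iff_isUnit_det _).2 (hinv (k + 1) (by omega)))]
      rfl
  refine ⟨L, ?_, hLpos, ?_, fun X hX hXeq => hmax X hX (sub_eq_of_eq_add hXeq.symm)⟩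
  · rw [← tendsto_add_atTop_iff_nat 1]
    simp_rw [hodd]
    exact hL.comp (StrictMono.tendsto_atTop (φ := fun k : ℕ => 2 * k + 1)
      fun a b h => by dsimp only; omega)
  · exact (eq_add_of_sub_eq hfix).symm
end

section
/- Let d be a positive real number, σ² ≥ 0 a real number, and φ ∈ ℝ. Then there exist real numbers u and v with 1 + du > 0 such that σ² + φ²/d = u + d v² (1 + d u) and −φ/d = v (1 + d u). Equivalently, the quadratic equation d u² + (1 − d σ² − φ²) u − σ² = 0 has a real root u with 1 + du > 0 (its discriminant equals (1 − dσ² − φ²)² + 4dσ², which is nonnegative), and v = −φ / (d(1 + du)). -/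
/-- A quadratic with positive leading coefficient and nonpositive constant term has a
nonnegative root. -/
theorem exists_nonneg_root_quadratic {a b c : ℝ} (ha : 0 < a) (hc : 0 ≤ c) :
    ∃ u : ℝ, 0 ≤ u ∧ a * u ^ 2 + b * u - c = 0 := by
  have hac : 0 ≤ 4 * a * c := by positivity
  obtain ⟨s, hs, hb⟩ : ∃ s : ℝ, s ^ 2 = b ^ 2 + 4 * a * c ∧ b ≤ s :=
    ⟨√(b ^ 2 + 4 * a * c), Real.sq_sqrt (by positivity), Real.le_sqrt_of_sq_le (by linarith)⟩
  refine ⟨(s - b) / (2 * a), div_nonneg (by linarith) (by positivity), ?_⟩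
  field_simp
  linear_combination hs

/-- Solvability of the scalar system (onedim-sol) from Section 3.1 (one factor, `p = 1`):
there exist reals `u, v` with `1 + du > 0` solving
`σ² + φ²/d = u + dv²(1 + du)` and `-φ/d = v(1 + du)`; equivalently, the quadratic
`du² + (1 - dσ² - φ²)u - σ² = 0` (whose discriminant `(1 - dσ² - φ²)² + 4dσ²` is
nonnegative) has a real root `u` with `1 + du > 0`, and `v = -φ/(d(1 + du))`. -/
theorem onedim_system_solvable
    (d : ℝ) (hd : 0 < d) (σ2 : ℝ) (hσ2 : 0 ≤ σ2) (φ : ℝ) :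
    (0 ≤ (1 - d * σ2 - φ ^ 2) ^ 2 + 4 * d * σ2) ∧
    ∃ u v : ℝ, 0 < 1 + d * u ∧
      σ2 + φ ^ 2 / d = u + d * v ^ 2 * (1 + d * u) ∧
      -φ / d = v * (1 + d * u) ∧
      d * u ^ 2 + (1 - d * σ2 - φ ^ 2) * u - σ2 = 0 ∧
      v = -φ / (d * (1 + d * u)) := by
  refine ⟨by positivity, ?_⟩
  obtain ⟨u, hu, hroot⟩ := exists_nonneg_root_quadratic (b := 1 - d * σ2 - φ ^ 2) hd hσ2
  have hpos : 0 < 1 + d * u := by positivity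
  refine ⟨u, -φ / (d * (1 + d * u)), hpos, ?_, ?_, hroot, rfl⟩
  · field_simp
    linear_combination -d * hroot
  · field_simp
end
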